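/- Let r ∈ ℕ with r ≥ 2 and p ∈ (0,1). Let N₁ be negative binomial with parameters r and p, and N₂ be negative binomial with parameters r and 1−p, independent, and let δ̂ = −H_{N₁−1} + H_{N₂−1}. Then Var[δ̂] = E[(δ̂ − log(p/(1−p)))²] satisfies Var[δ̂] < (1/(r − 5/4))·(1 − 7/(4r−1)²), where the expectation is the double series over n₁ ≥ r and n₂ ≥ r weighted by the negative binomial probabilities. -/

import Mathlib

open scoped BigOperators

/-- Expectation of `f(N)` where `N` is negative binomial with parameters `s` and `q`:
`E[f(N)] = Σ_{n ≥ s} f(n) C(n−1, s−1) q^s (1−q)^{n−s}`, written with `n = s + k`. -/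
noncomputable def negbinExp (s : ℕ) (q : ℝ) (f : ℕ → ℝ) : ℝ :=
  ∑' k : ℕ, ((s + k - 1).choose (s - 1) : ℝ) * q ^ s * (1 - q) ^ k * f (s + k)

/-- Expectation of `f(N₁, N₂)` for independent negative binomials with parameters
`(s₁, q₁)` and `(s₂, q₂)`. -/
noncomputable def negbinExp2 (s₁ : ℕ) (q₁ : ℝ) (s₂ : ℕ) (q₂ : ℝ) (f : ℕ → ℕ → ℝ) : ℝ :=
  ∑' k₁ : ℕ, ∑' k₂ : ℕ,
    ((s₁ + k₁ - 1).choose (s₁ - 1) : ℝ) * q₁ ^ s₁ * (1 - q₁) ^ k₁ *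
      (((s₂ + k₂ - 1).choose (s₂ - 1) : ℝ) * q₂ ^ s₂ * (1 - q₂) ^ k₂) *
      f (s₁ + k₁) (s₂ + k₂)

/-- The m-th harmonic number `H_m = Σ_{k=1}^m 1/k`, `H_0 = 0`. -/
noncomputable def H (m : ℕ) : ℝ := ∑ k ∈ Finset.range m, (1 : ℝ) / (k + 1)
lemma HasSum.congr_eq {f g : ℕ → ℝ} {a b : ℝ} (h : HasSum f a) (hfg : ∀ k, g k = f k)
    (hab : b = a) : HasSum g b := by
  rwa [hab, funext hfg]

lemma H_succ (m : ℕ) : H (m + 1) = H m + 1 / ((m : ℝ) + 1) := by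
  simp [H, Finset.sum_range_succ]

lemma H_add_sub_nonneg (s k : ℕ) : 0 ≤ H (s + k) - H s := by
  induction k with
  | zero => simp
  | succ k ih =>
    rw [← add_assoc, H_succ]
    have : 0 ≤ 1 / (((s + k : ℕ) : ℝ) + 1) := by positivity
    linarith

lemma H_add_sub_le (s k : ℕ) : H (s + k) - H s ≤ k := by
  induction k with
  | zero => simp
  | succ k ih =>
    rw [← add_assoc, H_succ]
    have : 1 / (((s + k : ℕ) : ℝ) + 1) ≤ 1 := by
      rw [div_le_one (by positivity)]
      linarith [(Nat.cast_nonneg (s + k) : (0 : ℝ) ≤ _)]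
    push_cast at this ⊢
    linarith

lemma summable_add_pow_mul_geometric (s m : ℕ) {x : ℝ} (hx0 : 0 < x) (hx1 : x < 1) :
    Summable fun k : ℕ => ((k : ℝ) + s + 1) ^ m * x ^ k := by
  have h := summable_pow_mul_geometric_of_norm_lt_one (R := ℝ) m (r := x)
    (by rwa [Real.norm_of_nonneg hx0.le])
  refine (((summable_nat_add_iff (s + 1)).2 h).mul_right (x ^ (s + 1))⁻¹).congr fun k => ?_
  rw [pow_add]
  push_cast
  field_simp
  ring

lemma summable_mul_pow_of_abs_le {c : ℕ → ℝ} {s m : ℕ}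
    (hc : ∀ k, |c k| ≤ ((k : ℝ) + s + 1) ^ m) {x : ℝ} (hx0 : 0 ≤ x) (hx1 : x < 1) :
    Summable fun k => c k * x ^ k := by
  obtain ⟨y, hxy, hy1⟩ := exists_between hx1
  refine Summable.of_norm_bounded
    (summable_add_pow_mul_geometric s m (hx0.trans_lt hxy) hy1) fun k => ?_
  rw [norm_mul, norm_pow, Real.norm_eq_abs, Real.norm_of_nonneg hx0]
  exact mul_le_mul (hc k) (pow_le_pow_left₀ hx0 hxy.le k) (by positivity) (by positivity)

/-- A power series with polynomially bounded coefficients can be differentiated termwise; the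
derivative times `1 - x` is recorded as a power series. -/
lemma exists_hasDerivAt_tsum_mul_pow {c : ℕ → ℝ} {s m : ℕ}
    (hc : ∀ k, |c k| ≤ ((k : ℝ) + s + 1) ^ m) {x : ℝ} (hx0 : 0 ≤ x) (hx1 : x < 1) :
    ∃ D, HasDerivAt (fun y => ∑' k, c k * y ^ k) D x ∧
      HasSum (fun k : ℕ => (((k : ℝ) + 1) * c (k + 1) - k * c k) * x ^ k) ((1 - x) * D) := by
  obtain ⟨ρ, hxρ, hρ1⟩ := exists_between hx1
  have hρ0 : 0 < ρ := hx0.trans_lt hxρ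
  have hu : Summable fun k : ℕ => ((k : ℝ) + s + 1) ^ (m + 1) * ρ ^ k * ρ⁻¹ :=
    (summable_add_pow_mul_geometric s (m + 1) hρ0 hρ1).mul_right _
  have hbound : ∀ k : ℕ, ∀ y ∈ Set.Ioo (-ρ) ρ,
      ‖c k * ((k : ℝ) * y ^ (k - 1))‖ ≤ ((k : ℝ) + s + 1) ^ (m + 1) * ρ ^ k * ρ⁻¹ := by
    intro k y hy
    rcases k with _ | k
    · simp only [Nat.cast_zero, zero_mul, mul_zero, norm_zero]
      positivity
    · have hyρ : |y| ≤ ρ := abs_le.2 ⟨hy.1.le, hy.2.le⟩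
      have h1 : ((k + 1 : ℕ) : ℝ) ≤ ((k + 1 : ℕ) : ℝ) + s + 1 := by
        have : (0 : ℝ) ≤ s := Nat.cast_nonneg s
        linarith
      have h2 : |y| ^ k ≤ ρ ^ k := pow_le_pow_left₀ (abs_nonneg _) hyρ k
      rw [Real.norm_eq_abs, abs_mul, abs_mul, abs_pow, Nat.abs_cast, Nat.add_sub_cancel]
      calc |c (k + 1)| * (((k + 1 : ℕ) : ℝ) * |y| ^ k)
          ≤ (((k + 1 : ℕ) : ℝ) + s + 1) ^ m * ((((k + 1 : ℕ) : ℝ) + s + 1) * ρ ^ k) := by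
            gcongr
            exact hc (k + 1)
        _ = _ := by
            field_simp
            ring
  have hxm : x ∈ Set.Ioo (-ρ) ρ := ⟨by linarith, hxρ⟩
  have hder := hasDerivAt_tsum_of_isPreconnected (g := fun k y => c k * y ^ k)
    (g' := fun k y => c k * ((k : ℝ) * y ^ (k - 1))) hu isOpen_Ioo isPreconnected_Ioo
    (fun k y _ => (hasDerivAt_pow k y).const_mul (c k)) hbound hxm
    (summable_mul_pow_of_abs_le hc hx0 hx1) hxm
  have hs : HasSum (fun k : ℕ => c k * ((k : ℝ) * x ^ (k - 1)))
      (∑' k : ℕ, c k * ((k : ℝ) * x ^ (k - 1))) :=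
    (Summable.of_norm_bounded hu fun k => hbound k x hxm).hasSum
  refine ⟨_, hder, ?_⟩
  have hshift := (hasSum_nat_add_iff' 1).2 hs
  refine (hshift.sub (hs.mul_left x)).congr_eq (fun k => ?_) ?_
  · rcases k with _ | k
    · simp
    · simp only [Nat.add_sub_cancel]
      push_cast
      ring
  · simp
    ring

lemma succ_mul_choose_succ_add (s k : ℕ) :
    ((k : ℝ) + 1) * ((k + 1 + s).choose s : ℝ) = (k + s + 1) * ((k + s).choose s : ℝ) := by
  have h := Nat.choose_mul_succ_eq (k + s) s
  rw [show k + s + 1 - s = k + 1 by omega, show k + s + 1 = k + 1 + s by omega] at h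
  have h' : ((k + s).choose s : ℝ) * (k + 1 + s) = (k + 1 + s).choose s * (k + 1) := by
    exact_mod_cast h
  linarith

lemma abs_choose_mul_H_pow_le (s m k : ℕ) :
    |((k + s).choose s : ℝ) * (H (s + k) - H s) ^ m| ≤ ((k : ℝ) + s + 1) ^ (s + m) := by
  have h0 := H_add_sub_nonneg s k
  have h1 := H_add_sub_le s k
  have hs : (0 : ℝ) ≤ s := Nat.cast_nonneg s
  have h2 : ((k + s).choose s : ℝ) ≤ ((k : ℝ) + s) ^ s := by
    exact_mod_cast Nat.choose_le_pow (k + s) s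
  rw [abs_of_nonneg (by positivity), pow_add]
  refine mul_le_mul (h2.trans ?_) (pow_le_pow_left₀ h0 (by linarith) m) (by positivity)
    (by positivity)
  exact pow_le_pow_left₀ (by positivity) (by linarith) s

lemma tsum_mul_pow_zero (c : ℕ → ℝ) : ∑' k, c k * (0 : ℝ) ^ k = c 0 := by
  rw [tsum_eq_single 0 fun k hk => by simp [hk]]
  simp

lemma hasDerivAt_neg_log_one_sub {x : ℝ} (hx1 : x < 1) :
    HasDerivAt (fun y : ℝ => -Real.log (1 - y)) (1 / (1 - x)) x := by
  have h := (((hasDerivAt_id x).const_sub 1).log (by simp; linarith)).neg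
  exact h.congr_deriv (by simp [neg_div])

lemma hasDerivAt_one_sub_pow_succ (s : ℕ) (x : ℝ) :
    HasDerivAt (fun y : ℝ => (1 - y) ^ (s + 1)) (-((s + 1) * (1 - x) ^ s)) x := by
  exact (((hasDerivAt_id x).const_sub 1).pow (s + 1)).congr_deriv (by simp)

/-- `H_{N-1} - H_s` has mean `-log (1 - x)` for `N` negative binomial with parameters
`s + 1` and `1 - x`. -/
lemma tsum_choose_mul_H (s : ℕ) {x : ℝ} (hx0 : 0 ≤ x) (hx1 : x < 1) :
    (1 - x) ^ (s + 1) * ∑' k : ℕ, ((k + s).choose s : ℝ) * (H (s + k) - H s) ^ 1 * x ^ k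
      = -Real.log (1 - x) := by
  have hder : ∀ y ∈ Set.Icc 0 x, HasDerivAt (fun y => (1 - y) ^ (s + 1) *
      (∑' k : ℕ, ((k + s).choose s : ℝ) * (H (s + k) - H s) ^ 1 * y ^ k)
        - -Real.log (1 - y)) 0 y := by
    intro y hy
    have hy1 : y < 1 := hy.2.trans_lt hx1
    have hpos : 0 < 1 - y := by linarith
    obtain ⟨D, hD, hsum⟩ :=
      exists_hasDerivAt_tsum_mul_pow (abs_choose_mul_H_pow_le s 1) hy.1 hy1
    have hA := hasSum_choose_mul_geometric_of_norm_lt_one (𝕜 := ℝ) s (r := y)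
      (by rwa [Real.norm_of_nonneg hy.1])
    have hB := (summable_mul_pow_of_abs_le (abs_choose_mul_H_pow_le s 1) hy.1 hy1).hasSum
    have hrec : (1 - y) * D = (s + 1) *
        (∑' k : ℕ, ((k + s).choose s : ℝ) * (H (s + k) - H s) ^ 1 * y ^ k)
          + 1 / (1 - y) ^ (s + 1) := by
      refine hsum.unique ?_
      refine ((hB.mul_left ((s : ℝ) + 1)).add hA).congr_eq (fun k => ?_) rfl
      have hc := succ_mul_choose_succ_add s k
      have hk : (k : ℝ) + s + 1 ≠ 0 := by positivity
      have hinv : (1 : ℝ) / (s + k + 1) * (k + s + 1) = 1 := by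
        rw [add_comm (s : ℝ)]; field_simp
      rw [← add_assoc s k 1, H_succ]
      push_cast
      linear_combination (H (s + k) - H s + 1 / ((s : ℝ) + k + 1)) * y ^ k * hc
        + ((k + s).choose s : ℝ) * y ^ k * hinv
    refine (((hasDerivAt_one_sub_pow_succ s y).mul hD).sub
      (hasDerivAt_neg_log_one_sub hy1)).congr_deriv ?_
    have : (1 - y) ^ (s + 1) * D = (1 - y) ^ s * ((1 - y) * D) := by ring
    rw [this, hrec]
    field_simp
    ring
  have h := constant_of_has_deriv_right_zero
    (fun y hy => (hder y hy).continuousAt.continuousWithinAt)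
    (fun y hy => (hder y ⟨hy.1, hy.2.le⟩).hasDerivWithinAt) x ⟨hx0, le_rfl⟩
  simp only [tsum_mul_pow_zero] at h
  simp only [add_zero, sub_self, sub_zero, Real.log_one, neg_zero, pow_one, mul_zero] at h
  simp only [pow_one]
  linarith

/-- The variance of `H_{N-1}` is at most `x / s` for `N` negative binomial with parameters
`s + 1` and `1 - x`. -/
lemma tsum_choose_mul_H_sq_le (t : ℕ) {x : ℝ} (hx0 : 0 ≤ x) (hx1 : x < 1) :
    (1 - x) ^ (t + 1 + 1) *
        (∑' k : ℕ, ((k + (t + 1)).choose (t + 1) : ℝ) * (H (t + 1 + k) - H (t + 1)) ^ 2 * x ^ k)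
      - (-Real.log (1 - x)) ^ 2 ≤ x / (t + 1) := by
  set s := t + 1 with hs
  have hder : ∀ y ∈ Set.Icc 0 x, ∃ F', F' ≤ 1 / ((t : ℝ) + 1) ∧
      HasDerivAt (fun y => (1 - y) ^ (s + 1) *
      (∑' k : ℕ, ((k + s).choose s : ℝ) * (H (s + k) - H s) ^ 2 * y ^ k)
        - (-Real.log (1 - y)) ^ 2) F' y := by
    intro y hy
    have hy1 : y < 1 := hy.2.trans_lt hx1
    have hpos : 0 < 1 - y := by linarith
    obtain ⟨D, hD, hsum⟩ :=
      exists_hasDerivAt_tsum_mul_pow (abs_choose_mul_H_pow_le s 2) hy.1 hy1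
    have hA := hasSum_choose_mul_geometric_of_norm_lt_one (𝕜 := ℝ) t (r := y)
      (by rwa [Real.norm_of_nonneg hy.1])
    have hB := (summable_mul_pow_of_abs_le (abs_choose_mul_H_pow_le s 1) hy.1 hy1).hasSum
    have hC := (summable_mul_pow_of_abs_le (abs_choose_mul_H_pow_le s 2) hy.1 hy1).hasSum
    have hmean := tsum_choose_mul_H s hy.1 hy1
    set B := ∑' k : ℕ, ((k + s).choose s : ℝ) * (H (s + k) - H s) ^ 1 * y ^ k
    set C := ∑' k : ℕ, ((k + s).choose s : ℝ) * (H (s + k) - H s) ^ 2 * y ^ k with hCdef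
    have hrec : (1 - y) * D ≤ (s + 1) * C + 2 * B + 1 / (t + 1) * (1 / (1 - y) ^ (t + 1)) := by
      refine hasSum_le (fun k => ?_) hsum
        (((hC.mul_left ((s : ℝ) + 1)).add (hB.mul_left 2)).add (hA.mul_left (1 / ((t : ℝ) + 1))))
      have hc := succ_mul_choose_succ_add s k
      have hk : (k : ℝ) + s + 1 ≠ 0 := by positivity
      have hinv : (1 : ℝ) / (s + k + 1) * (k + s + 1) = 1 := by
        rw [add_comm (s : ℝ)]; field_simp
      have hchoose : ((k + s).choose s : ℝ) / (s + k + 1) ≤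
          1 / (t + 1) * ((k + t).choose t : ℝ) := by
        have h : ((k : ℝ) + t + 1) * (k + t).choose t = (k + s).choose s * (t + 1) := by
          exact_mod_cast Nat.add_one_mul_choose_eq (k + t) t
        have hs' : (s : ℝ) = t + 1 := by rw [hs]; push_cast; ring
        have h' : ((k + s).choose s : ℝ) = ((k : ℝ) + t + 1) * (k + t).choose t / (t + 1) := by
          rw [h]; field_simp
        rw [h', div_le_iff₀ (by positivity), hs', one_div_mul_eq_div, div_mul_eq_mul_div]
        refine div_le_div_of_nonneg_right ?_ (by positivity)
        nlinarith [(Nat.cast_nonneg ((k + t).choose t) : (0 : ℝ) ≤ _)]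
      have hyk : 0 ≤ y ^ k := pow_nonneg hy.1 k
      have hm := mul_le_mul_of_nonneg_right hchoose hyk
      refine le_trans (le_of_eq ?_) (add_le_add_right (hm.trans_eq (mul_assoc _ _ _)) _)
      rw [← add_assoc s k 1, H_succ]
      push_cast
      rw [div_eq_mul_one_div ((k + s).choose s : ℝ)]
      linear_combination (H (s + k) - H s + 1 / ((s : ℝ) + k + 1)) ^ 2 * y ^ k * hc
        + ((k + s).choose s : ℝ) * y ^ k *
          (2 * (H (s + k) - H s) + 1 / ((s : ℝ) + k + 1)) * hinv
    refine ⟨_, ?_, ((hasDerivAt_one_sub_pow_succ s y).mul hD).sub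
      ((hasDerivAt_neg_log_one_sub hy1).pow 2)⟩
    have hmul := mul_le_mul_of_nonneg_left hrec (pow_nonneg hpos.le s)
    have e1 : (1 - y) ^ s * (1 / (t + 1) * (1 / (1 - y) ^ (t + 1))) = 1 / ((t : ℝ) + 1) := by
      rw [← hs]; field_simp
    have e2 : -Real.log (1 - y) * (1 / (1 - y)) = (1 - y) ^ s * B := by
      rw [← hmean, pow_succ]; field_simp
    norm_num only [Nat.cast_ofNat, pow_one]
    rw [← hCdef]
    rw [pow_succ (1 - y) s]
    linarith
  choose! F' hF' hF using hder
  have h := image_le_of_deriv_right_le_deriv_boundary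
    (fun y hy => (hF y hy).continuousAt.continuousWithinAt)
    (fun y hy => (hF y ⟨hy.1, hy.2.le⟩).hasDerivWithinAt)
    (B := fun y => y / ((t : ℝ) + 1)) (B' := fun _ => 1 / ((t : ℝ) + 1))
    (by simp only [tsum_mul_pow_zero]; simp) (by fun_prop)
    (fun y _ => ((hasDerivAt_id y).div_const _).hasDerivWithinAt)
    (fun y hy => hF' y ⟨hy.1, hy.2.le⟩)
  exact h ⟨hx0, le_rfl⟩

/-- The centred variable `H_{N-1} - H_{r-1} + log q` has mean `0` and variance at most
`(1 - q) / (r - 1)` for `N` negative binomial with parameters `r` and `q`. -/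
lemma negbin_harmonic_moments (r : ℕ) (hr : 2 ≤ r) (q : ℝ) (hq0 : 0 < q) (hq1 : q < 1) :
    ∃ v ≤ (1 - q) / ((r : ℝ) - 1),
      HasSum (fun k : ℕ => ((r + k - 1).choose (r - 1) : ℝ) * q ^ r * (1 - q) ^ k) 1 ∧
      HasSum (fun k : ℕ => ((r + k - 1).choose (r - 1) : ℝ) * q ^ r * (1 - q) ^ k *
        (H (r + k - 1) - H (r - 1) + Real.log q)) 0 ∧
      HasSum (fun k : ℕ => ((r + k - 1).choose (r - 1) : ℝ) * q ^ r * (1 - q) ^ k *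
        (H (r + k - 1) - H (r - 1) + Real.log q) ^ 2) v := by
  obtain ⟨t, rfl⟩ : ∃ t, r = t + 1 + 1 := ⟨r - 2, by omega⟩
  have hx0 : 0 ≤ 1 - q := by linarith
  have hx1 : 1 - q < 1 := by linarith
  have hA := (hasSum_choose_mul_geometric_of_norm_lt_one (𝕜 := ℝ) (t + 1) (r := 1 - q)
      (by rwa [Real.norm_of_nonneg hx0])).mul_left (q ^ (t + 1 + 1))
  have hB := (summable_mul_pow_of_abs_le
    (abs_choose_mul_H_pow_le (t + 1) 1) hx0 hx1).hasSum.mul_left (q ^ (t + 1 + 1))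
  have hC := (summable_mul_pow_of_abs_le
    (abs_choose_mul_H_pow_le (t + 1) 2) hx0 hx1).hasSum.mul_left (q ^ (t + 1 + 1))
  have hmean := tsum_choose_mul_H (t + 1) hx0 hx1
  have hvar := tsum_choose_mul_H_sq_le t hx0 hx1
  rw [sub_sub_cancel] at hA hmean hvar
  rw [hmean] at hB
  rw [mul_one_div_cancel (by positivity)] at hA
  have hidx : ∀ k : ℕ, t + 1 + 1 + k - 1 = t + 1 + k := fun k => by omega
  simp only [hidx, Nat.add_sub_cancel]
  simp only [add_comm _ (t + 1)] at hA hB hC hvar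
  refine ⟨_, ?_, ?_, ?_, ((hC.add (hB.mul_left (2 * Real.log q))).add
    (hA.mul_left (Real.log q ^ 2))).congr_eq (fun k => by ring) rfl⟩
  · refine le_trans (le_of_eq ?_) (hvar.trans_eq ?_)
    · ring
    · push_cast
      ring
  · refine hA.congr_eq (fun k => ?_) rfl
    ring
  · refine (hB.add (hA.mul_left (Real.log q))).congr_eq (fun k => ?_) ?_ <;> ring

/-- For independent discrete variables given by weights, the second moment of a difference is the
sum of the second moments once one of the variables is centred. -/
lemma tsum_tsum_mul_sub_sq {w₁ w₂ X Y : ℕ → ℝ} {v₁ v₂ : ℝ} (h₁ : HasSum w₁ 1)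
    (hX2 : HasSum (fun k => w₁ k * X k ^ 2) v₁)
    (h₂ : HasSum w₂ 1) (hY : HasSum (fun k => w₂ k * Y k) 0)
    (hY2 : HasSum (fun k => w₂ k * Y k ^ 2) v₂) :
    ∑' k₁, ∑' k₂, w₁ k₁ * w₂ k₂ * (-X k₁ + Y k₂) ^ 2 = v₁ + v₂ := by
  have hinner : ∀ k₁, ∑' k₂, w₁ k₁ * w₂ k₂ * (-X k₁ + Y k₂) ^ 2
      = w₁ k₁ * X k₁ ^ 2 + w₁ k₁ * v₂ := by
    intro k₁
    refine HasSum.tsum_eq ?_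
    refine (((h₂.mul_left (w₁ k₁ * X k₁ ^ 2)).add (hY.mul_left (-2 * w₁ k₁ * X k₁))).add
      (hY2.mul_left (w₁ k₁))).congr_eq (fun k₂ => ?_) ?_ <;> ring
  simp only [hinner]
  simpa using (hX2.add (h₁.mul_right v₂)).tsum_eq

theorem log_odds_estimator_variance_bound_guar (r : ℕ) (hr : 2 ≤ r) (p : ℝ)
    (hp0 : 0 < p) (hp1 : p < 1) :
    negbinExp2 r p r (1 - p)
        (fun n₁ n₂ => (-H (n₁ - 1) + H (n₂ - 1) - Real.log (p / (1 - p))) ^ 2) <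
      (1 / ((r : ℝ) - 5 / 4)) * (1 - 7 / (4 * (r : ℝ) - 1) ^ 2) := by
  obtain ⟨v₁, hv₁, hA₁, -, hC₁⟩ := negbin_harmonic_moments r hr p hp0 hp1
  obtain ⟨v₂, hv₂, hA₂, hB₂, hC₂⟩ :=
    negbin_harmonic_moments r hr (1 - p) (by linarith) (by linarith)
  have hlog : Real.log (p / (1 - p)) = Real.log p - Real.log (1 - p) :=
    Real.log_div hp0.ne' (by linarith)
  have hr' : (2 : ℝ) ≤ r := by exact_mod_cast hr
  have hvar : negbinExp2 r p r (1 - p)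
      (fun n₁ n₂ => (-H (n₁ - 1) + H (n₂ - 1) - Real.log (p / (1 - p))) ^ 2) = v₁ + v₂ := by
    rw [← tsum_tsum_mul_sub_sq hA₁ hC₁ hA₂ hB₂ hC₂, negbinExp2]
    refine tsum_congr fun k₁ => tsum_congr fun k₂ => ?_
    rw [hlog]
    ring
  have hsum : (1 - p) / ((r : ℝ) - 1) + (1 - (1 - p)) / ((r : ℝ) - 1) = 1 / (r - 1) := by
    rw [← add_div]
    congr 1
    ring
  have hbound : 1 / ((r : ℝ) - 1) < 1 / (r - 5 / 4) * (1 - 7 / (4 * r - 1) ^ 2) := by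
    have e1 : (0 : ℝ) < r - 1 := by linarith
    have e2 : (0 : ℝ) < r - 5 / 4 := by linarith
    have e3 : (0 : ℝ) < 4 * r - 1 := by linarith
    rw [one_sub_div (by positivity), div_mul_div_comm, one_mul,
      div_lt_div_iff₀ e1 (by positivity)]
    nlinarith [sq_nonneg (8 * (r : ℝ) - 9)]
  linarith
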